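/- arXiv:1910.07985 — 2 statements merged into one kernel-verified Lean document; each statement's English description precedes it below -/
import Mathlib

section
/- Let R be a countable Borel equivalence relation on a standard Borel space X and μ a Borel probability measure on X. Define measures μ_l and μ_r on R by ∫ f dμ_l = ∫_X Σ_{y ∈ [x]} f(x,y) dμ(x) and ∫ f dμ_r = ∫_X Σ_{y ∈ [x]} f(y,x) dμ(x). Then μ_l = μ_r if and only if μ is invariant under every Borel automorphism of X whose graph is contained in R. -/
open MeasureTheory
open scoped ENNReal

lemma aux_tube (k : ℕ → ℕ) (V : Set (ℕ → ℕ)) (hV : IsOpen V)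
    (hK : {z : ℕ → ℕ | ∀ i, z i ≤ k i} ⊆ V) :
    ∃ N, {z : ℕ → ℕ | ∀ i < N, z i ≤ k i} ⊆ V := by
  have hc : IsCompact {z : ℕ → ℕ | ∀ i, z i ≤ k i} := by
    have := isCompact_univ_pi (X := fun _ : ℕ => ℕ) (s := fun i => Set.Iic (k i))
      (fun i => (Set.finite_Iic (k i)).isCompact)
    convert this using 1
    ext z; simp [Pi.le_def]
  have h1 : ∀ z : ℕ → ℕ, ∃ n, z ∈ V → PiNat.cylinder z n ⊆ V := by
    intro z
    by_cases hz : z ∈ V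
    · obtain ⟨u, ⟨x, n, rfl⟩, hzu, hu⟩ :=
        (PiNat.isTopologicalBasis_cylinders (fun _ : ℕ => ℕ)).exists_subset_of_mem_open hz hV
      refine ⟨n, fun _ => ?_⟩
      rw [PiNat.mem_cylinder_iff_eq.1 hzu]
      exact hu
    · exact ⟨0, fun h => absurd h hz⟩
  choose n hn using h1
  obtain ⟨t, htK, ht⟩ := hc.elim_nhds_subcover (fun z => PiNat.cylinder z (n z))
    (fun z _ => (PiNat.isOpen_cylinder _ z (n z)).mem_nhds (PiNat.self_mem_cylinder z (n z)))
  refine ⟨t.sup n, fun z hz => ?_⟩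
  let z' : ℕ → ℕ := fun i => if i < t.sup n then z i else 0
  have hz' : z' ∈ {z : ℕ → ℕ | ∀ i, z i ≤ k i} := by
    intro i
    by_cases h : i < t.sup n
    · simp only [z', if_pos h]; exact hz i h
    · simp only [z', if_neg h]; exact Nat.zero_le _
  obtain ⟨w, hw, hzw⟩ := Set.mem_iUnion₂.1 (ht hz')
  apply hn w (hK (htK w hw))
  rw [PiNat.mem_cylinder_iff] at hzw ⊢
  intro i hi
  have hi' : i < t.sup n := lt_of_lt_of_le hi (Finset.le_sup (f := n) hw)
  have := hzw i hi
  simp only [z', if_pos hi'] at this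
  exact this

lemma aux_inner {X : Type*} [TopologicalSpace X] [PolishSpace X] [MeasurableSpace X] [BorelSpace X]
    (μ : Measure X) [IsFiniteMeasure μ] (f : (ℕ → ℕ) → X) (hf : Continuous f) (c : ℝ≥0∞)
    (hc : c < μ (Set.range f)) : ∃ B ⊆ Set.range f, MeasurableSet B ∧ c ≤ μ B := by
  let := TopologicalSpace.upgradeIsCompletelyMetrizable X
  -- extension step
  let C : List ℕ → Set (ℕ → ℕ) := fun l => {z | ∀ i (h : i < l.length), z i ≤ l[i]}
  have step : ∀ l : {l : List ℕ // c < μ (f '' C l)}, ∃ m, c < μ (f '' C (l.1 ++ [m])) := by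
    rintro ⟨l, hl⟩
    have hU : C l = ⋃ m, C (l ++ [m]) := by
      ext z
      simp only [C, Set.mem_ofPred_eq, Set.mem_iUnion]
      constructor
      · intro h
        refine ⟨z l.length, fun i hi => ?_⟩
        simp only [List.length_append, List.length_singleton] at hi
        by_cases hil : i < l.length
        · rw [List.getElem_append_left hil]; exact h i hil
        · have : i = l.length := by omega
          subst this; simp
      · rintro ⟨m, h⟩ i hi
        have := h i (by simp; omega)
        rwa [List.getElem_append_left hi] at this
    have hmono : Monotone fun m => f '' C (l ++ [m]) := by
      intro a b hab
      apply Set.image_mono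
      intro z hz i hi
      refine (hz i (by simpa using hi)).trans ?_
      by_cases hil : i < l.length
      · rw [List.getElem_append_left hil, List.getElem_append_left hil]
      · have : i = l.length := by simp at hi; omega
        subst this; simpa using hab
    rw [hU, Set.image_iUnion, hmono.measure_iUnion, lt_iSup_iff] at hl
    exact hl
  choose m hm using step
  have h0 : c < μ (f '' C []) := by
    have : C [] = Set.univ := by ext; simp [C]
    rw [this, Set.image_univ]; exact hc
  let L : ℕ → {l : List ℕ // c < μ (f '' C l)} := fun n =>
    Nat.rec ⟨[], h0⟩ (fun _ l => ⟨l.1 ++ [m l], hm l⟩) n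
  have hLs : ∀ n, (L (n+1)).1 = (L n).1 ++ [m (L n)] := fun n => rfl
  let k : ℕ → ℕ := fun n => m (L n)
  have hL : ∀ n, (L n).1 = (List.range n).map k := by
    intro n
    induction n with
    | zero => rfl
    | succ n ih => rw [hLs, ih, List.range_succ, List.map_append]; rfl
  have hCL : ∀ n, C (L n).1 = {z : ℕ → ℕ | ∀ i < n, z i ≤ k i} := by
    intro n
    rw [hL]
    ext z; simp [C]
  have hK : IsCompact {z : ℕ → ℕ | ∀ i, z i ≤ k i} := by
    have := isCompact_univ_pi (X := fun _ : ℕ => ℕ) (s := fun i => Set.Iic (k i))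
      (fun i => (Set.finite_Iic (k i)).isCompact)
    convert this using 1
    ext z; simp [Pi.le_def]
  refine ⟨f '' {z : ℕ → ℕ | ∀ i, z i ≤ k i}, Set.image_subset_range _ _,
    (hK.image hf).measurableSet, ?_⟩
  by_contra! hlt
  obtain ⟨U, hU, hUo, hUc⟩ := Set.exists_isOpen_lt_of_lt _ _ hlt
  obtain ⟨N, hN⟩ := aux_tube k (f ⁻¹' U) (hUo.preimage hf) (Set.image_subset_iff.1 hU)
  have h2 := (L N).2
  rw [hCL] at h2
  exact absurd (h2.trans_le (measure_mono (Set.image_subset_iff.2 hN))) (not_lt.2 hUc.le)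

lemma aux_analytic {X : Type*} [TopologicalSpace X] [PolishSpace X] [MeasurableSpace X]
    [BorelSpace X] (μ : Measure X) [IsFiniteMeasure μ] (A : Set X) (hA : AnalyticSet A) :
    NullMeasurableSet A μ := by
  rw [AnalyticSet] at hA
  rcases hA with rfl | ⟨f, hf, rfl⟩
  · exact MeasurableSet.empty.nullMeasurableSet
  rcases eq_or_ne (μ (Set.range f)) 0 with h0 | h0
  · exact NullMeasurableSet.of_null h0
  obtain ⟨u, -, hu, hut⟩ := exists_seq_strictMono_tendsto' (pos_iff_ne_zero.2 h0)
  choose B hB hBm hBc using fun n => aux_inner μ f hf (u n) (hu n).2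
  have : (⋃ n, B n) =ᵐ[μ] Set.range f := by
    apply ae_eq_of_subset_of_measure_ge (Set.iUnion_subset hB) _
      (MeasurableSet.iUnion hBm).nullMeasurableSet (measure_ne_top _ _)
    exact le_of_tendsto' hut fun n => (hBc n).trans (measure_mono (Set.subset_iUnion B n))
  exact (MeasurableSet.iUnion hBm).nullMeasurableSet.congr this

lemma aux_image {Z X : Type*} [MeasurableSpace Z] [StandardBorelSpace Z] [MeasurableSpace X]
    [StandardBorelSpace X] (μ : Measure X) [IsFiniteMeasure μ] (f : Z → X) (hf : Measurable f)
    (s : Set Z) (hs : MeasurableSet s) : NullMeasurableSet (f '' s) μ := by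
  let := upgradeStandardBorel X
  exact aux_analytic μ _ (hs.analyticSet_image hf)

/-- `P` has closed fibers and its complement is a countable union of injective pieces -/
def AuxGood {Z X : Type*} [TopologicalSpace Z] [MeasurableSpace Z] (f : Z → X) (P : Set Z) : Prop :=
  MeasurableSet P ∧ (∀ x, IsClosed (P ∩ f ⁻¹' {x})) ∧
    ∃ 𝓑 : Set (Set Z), 𝓑.Countable ∧ (∀ B ∈ 𝓑, MeasurableSet B ∧ Set.InjOn f B) ∧ Pᶜ ⊆ ⋃₀ 𝓑

lemma auxGood_iInter {Z X ι : Type*} [TopologicalSpace Z] [MeasurableSpace Z] [Countable ι]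
    [Nonempty ι] (f : Z → X) (P : ι → Set Z) (h : ∀ i, AuxGood f (P i)) :
    AuxGood f (⋂ i, P i) := by
  choose h1 h2 𝓑 hc hB hs using h
  refine ⟨MeasurableSet.iInter h1, fun x => ?_, ⋃ i, 𝓑 i, Set.countable_iUnion hc, ?_, ?_⟩
  · rw [Set.iInter_inter]
    exact isClosed_iInter fun i => h2 i x
  · intro B hBm
    obtain ⟨i, hi⟩ := Set.mem_iUnion.1 hBm
    exact hB i B hi
  · rw [Set.compl_iInter]
    refine Set.iUnion_subset fun i => (hs i).trans ?_
    exact Set.sUnion_mono (Set.subset_iUnion 𝓑 i)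

lemma aux_isolated {Z : Type*} [TopologicalSpace Z] [PolishSpace Z] (C : Set Z) (hC : IsClosed C)
    (hcount : C.Countable) (hne : C.Nonempty) : ∃ x ∈ C, ∃ U ∈ nhds x, ∀ y ∈ U ∩ C, y = x := by
  by_contra! hcon
  let := TopologicalSpace.upgradeIsCompletelyMetrizable Z
  have hp : Perfect C := ⟨hC, preperfect_iff_nhds.2 hcon⟩
  obtain ⟨g, hg, -, hgi⟩ := hp.exists_nat_bool_injection hne
  have h1 : (Set.range g).Countable := hcount.mono hg
  have h2 : Countable (ℕ → Bool) := by
    have := h1.to_subtype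
    exact (Equiv.ofInjective g hgi).countable_iff.2 this
  have h3 : Cardinal.mk (ℕ → Bool) ≤ Cardinal.aleph0 := Cardinal.mk_le_aleph0
  rw [← Cardinal.power_def] at h3
  simp at h3
  exact absurd h3 (not_le.2 (Cardinal.cantor _))

lemma aux_LN_top {Z X : Type*} [TopologicalSpace Z] [PolishSpace Z] [MeasurableSpace Z]
    [BorelSpace Z] [TopologicalSpace X] [PolishSpace X] [MeasurableSpace X] [BorelSpace X]
    (μ : Measure X) [IsFiniteMeasure μ] (f : Z → X) (hf : Continuous f)
    (hcount : ∀ x, (f ⁻¹' {x}).Countable) :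
    ∃ 𝓑 : Set (Set Z), 𝓑.Countable ∧ (∀ B ∈ 𝓑, MeasurableSet B ∧ Set.InjOn f B) ∧
      μ (f '' (⋃₀ 𝓑)ᶜ) = 0 := by
  obtain ⟨b, hbc, -, hb⟩ := TopologicalSpace.exists_countable_basis Z
  have : Countable b := hbc.to_subtype
  have himg := aux_image μ f hf.measurable
  have hguniv : AuxGood f Set.univ := ⟨MeasurableSet.univ, fun x => by
    rw [Set.univ_inter]; exact isClosed_singleton.preimage hf, ∅, Set.countable_empty,
      by simp, by simp⟩
  -- a good set minimizing all the measures simultaneously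
  have hmin : ∃ P, AuxGood f P ∧ ∀ Q, AuxGood f Q → ∀ s ∈ b, μ (f '' (P ∩ s)) ≤ μ (f '' (Q ∩ s)) := by
    rcases isEmpty_or_nonempty b with hbe | hbne
    · exact ⟨Set.univ, hguniv, fun Q hQ s hs => (hbe.false ⟨s, hs⟩).elim⟩
    let m : b → ℝ≥0∞ := fun s => ⨅ Q : {Q // AuxGood f Q}, μ (f '' (Q.1 ∩ s.1))
    have hne : Nonempty {Q // AuxGood f Q} := ⟨⟨_, hguniv⟩⟩
    have hmt : ∀ s, m s ≠ ⊤ := fun s =>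
      ne_top_of_le_ne_top (measure_ne_top μ _) (iInf_le _ ⟨_, hguniv⟩)
    have hex : ∀ p : b × ℕ, ∃ Q : {Q // AuxGood f Q},
        μ (f '' (Q.1 ∩ p.1.1)) < m p.1 + ((p.2 : ℝ≥0∞) + 1)⁻¹ := by
      intro p
      apply iInf_lt_iff.1
      exact ENNReal.lt_add_right (hmt _) (by simp)
    choose Q hQ using hex
    refine ⟨⋂ p, (Q p).1, auxGood_iInter f _ fun p => (Q p).2, fun Q' hQ' s hs => ?_⟩
    refine le_trans ?_ (iInf_le (fun Q : {Q // AuxGood f Q} => μ (f '' (Q.1 ∩ s))) ⟨Q', hQ'⟩)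
    change _ ≤ m ⟨s, hs⟩
    have hle : ∀ n : ℕ, μ (f '' ((⋂ p, (Q p).1) ∩ s)) ≤ m ⟨s, hs⟩ + ((n : ℝ≥0∞) + 1)⁻¹ := by
      intro n
      refine le_trans (measure_mono ?_) (hQ (⟨s, hs⟩, n)).le
      exact Set.image_mono (Set.inter_subset_inter_left _ (Set.iInter_subset _ _))
    have ht : Filter.Tendsto (fun n : ℕ => m ⟨s, hs⟩ + ((n : ℝ≥0∞) + 1)⁻¹) Filter.atTop
        (nhds (m ⟨s, hs⟩ + 0)) := by
      refine Filter.Tendsto.const_add _ ?_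
      have := (Filter.tendsto_add_atTop_iff_nat 1).2 ENNReal.tendsto_inv_nat_nhds_zero
      simpa using this
    rw [add_zero] at ht
    exact ge_of_tendsto' ht hle
  obtain ⟨P, hP, hPmin⟩ := hmin
  obtain ⟨hPm, hPc, 𝓑, h𝓑c, h𝓑, hP𝓑⟩ := id hP
  -- the sets of unicity
  let U : Set Z → Set X := fun s => f '' (P ∩ s) \
    ((fun q : Z × Z => f q.1) '' (((P ∩ s) ×ˢ (P ∩ s)) ∩ {q | q.1 ≠ q.2 ∧ f q.1 = f q.2}))
  have hU : ∀ s ∈ b, NullMeasurableSet (U s) μ := by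
    intro s hs
    have hsm : MeasurableSet s := (hb.isOpen hs).measurableSet
    refine (himg _ (hPm.inter hsm)).diff (aux_image μ _ (hf.measurable.comp measurable_fst) _ ?_)
    refine ((hPm.inter hsm).prod (hPm.inter hsm)).inter (MeasurableSet.inter ?_ ?_)
    · exact (measurableSet_eq_fun measurable_fst measurable_snd).compl
    · exact measurableSet_eq_fun (hf.measurable.comp measurable_fst)
        (hf.measurable.comp measurable_snd)
  have hUinj : ∀ s, Set.InjOn f (P ∩ s ∩ f ⁻¹' (U s)) := by
    rintro s z ⟨hz, hzU⟩ z' ⟨hz', -⟩ hzz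
    by_contra hne
    exact hzU.2 ⟨(z, z'), ⟨⟨hz, hz'⟩, hne, hzz⟩, rfl⟩
  have hU0 : ∀ s ∈ b, μ (U s) = 0 := by
    intro s hs
    have hsm : MeasurableSet s := (hb.isOpen hs).measurableSet
    obtain ⟨W, hWU, hWm, hW⟩ := (hU s hs).exists_measurable_subset_ae_eq
    rw [← measure_congr hW]
    have hgood : AuxGood f (P \ (s ∩ f ⁻¹' W)) := by
      refine ⟨hPm.diff (hsm.inter (hf.measurable hWm)), fun x => ?_,
        insert (P ∩ s ∩ f ⁻¹' W) 𝓑, h𝓑c.insert _, ?_, ?_⟩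
      · by_cases hx : x ∈ W
        · have : P \ (s ∩ f ⁻¹' W) ∩ f ⁻¹' {x} = (P ∩ f ⁻¹' {x}) \ s := by
            ext z
            simp only [Set.mem_inter_iff, Set.mem_sdiff, Set.mem_preimage, Set.mem_singleton_iff]
            constructor
            · rintro ⟨⟨h1, h2⟩, rfl⟩
              exact ⟨⟨h1, rfl⟩, fun h => h2 ⟨h, hx⟩⟩
            · rintro ⟨⟨h1, rfl⟩, h2⟩
              exact ⟨⟨h1, fun h => h2 h.1⟩, rfl⟩
          rw [this]
          exact (hPc x).sdiff (hb.isOpen hs)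
        · have : P \ (s ∩ f ⁻¹' W) ∩ f ⁻¹' {x} = P ∩ f ⁻¹' {x} := by
            ext z
            simp only [Set.mem_inter_iff, Set.mem_sdiff, Set.mem_preimage, Set.mem_singleton_iff]
            constructor
            · rintro ⟨⟨h1, h2⟩, rfl⟩
              exact ⟨h1, rfl⟩
            · rintro ⟨h1, rfl⟩
              exact ⟨⟨h1, fun h => hx h.2⟩, rfl⟩
          rw [this]
          exact hPc x
      · rintro B (rfl | hB)
        · exact ⟨(hPm.inter hsm).inter (hf.measurable hWm),
            (hUinj s).mono (Set.inter_subset_inter_right _ (Set.preimage_mono hWU))⟩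
        · exact h𝓑 B hB
      · intro z hz
        rw [Set.sUnion_insert]
        by_cases hzP : z ∈ P
        · left
          by_contra hcon
          exact hz ⟨hzP, fun h => hcon ⟨⟨hzP, h.1⟩, h.2⟩⟩
        · exact Or.inr (hP𝓑 hzP)
    have hle := hPmin _ hgood s hs
    have hsub : f '' ((P \ (s ∩ f ⁻¹' W)) ∩ s) ⊆ f '' (P ∩ s) \ W := by
      rintro _ ⟨z, ⟨⟨h1, h2⟩, h3⟩, rfl⟩
      exact ⟨⟨z, ⟨h1, h3⟩, rfl⟩, fun h => h2 ⟨h3, h⟩⟩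
    have h4 := hle.trans (measure_mono hsub)
    have hWsub : W ⊆ f '' (P ∩ s) := hWU.trans Set.sdiff_subset
    rw [measure_sdiff hWsub hWm.nullMeasurableSet (measure_ne_top _ _)] at h4
    by_contra hW0
    have hpos : μ (f '' (P ∩ s)) ≠ 0 := fun h => hW0 (measure_mono_null hWsub h)
    exact absurd h4 (not_le.2 (ENNReal.sub_lt_self (measure_ne_top _ _) hpos hW0))
  refine ⟨𝓑, h𝓑c, h𝓑, ?_⟩
  refine measure_mono_null (t := ⋃ s ∈ b, U s) ?_ ((measure_biUnion_null_iff hbc).2 hU0)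
  rintro _ ⟨z, hz, rfl⟩
  have hzP : z ∈ P := by
    by_contra h
    exact hz (hP𝓑 h)
  obtain ⟨w, ⟨hwP, hwx⟩, V, hV, hVw⟩ := aux_isolated (P ∩ f ⁻¹' {f z}) (hPc _)
    ((hcount (f z)).mono Set.inter_subset_right) ⟨z, hzP, rfl⟩
  obtain ⟨s, hs, hws, hsV⟩ := hb.mem_nhds_iff.1 hV
  refine Set.mem_biUnion hs ⟨⟨w, ⟨hwP, hws⟩, hwx⟩, ?_⟩
  rintro ⟨⟨q1, q2⟩, ⟨⟨h1, h2⟩, hne, heq⟩, hq⟩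
  simp only at h1 h2 hne heq hq
  apply hne
  rw [hVw q1 ⟨hsV h1.2, h1.1, hq⟩, hVw q2 ⟨hsV h2.2, h2.1, heq.symm.trans hq⟩]

/-- measure-theoretic Lusin–Novikov theorem -/
lemma aux_LN {Z X : Type*} [MeasurableSpace Z] [StandardBorelSpace Z]
    [MeasurableSpace X] [StandardBorelSpace X]
    (μ : Measure X) [IsFiniteMeasure μ] (f : Z → X) (hf : Measurable f)
    (hcount : ∀ x, (f ⁻¹' {x}).Countable) :
    ∃ 𝓑 : Set (Set Z), 𝓑.Countable ∧ (∀ B ∈ 𝓑, MeasurableSet B ∧ Set.InjOn f B) ∧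
      μ (f '' (⋃₀ 𝓑)ᶜ) = 0 := by
  let := upgradeStandardBorel X
  let u := upgradeStandardBorel Z
  let t : TopologicalSpace Z := inferInstance
  have ht : PolishSpace Z := inferInstance
  have hbor : BorelSpace Z := inferInstance
  obtain ⟨t', hle, hfc, hpol⟩ := hf.exists_continuous
  have hb : @BorelSpace Z t' _ := by
    constructor
    rw [hbor.measurable_eq]
    exact (borel_eq_borel_of_le hpol ht hle).symm
  exact @aux_LN_top Z X t' hpol _ hb _ _ _ _ μ _ f hfc hcount

lemma aux_tsum_subsingleton {X : Type*} (p : X → Prop) (hp : ∀ a b, p a → p b → a = b) :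
    (∑' _ : {y : X // p y}, (1 : ℝ≥0∞)) = Set.indicator {_x : Unit | ∃ y, p y} 1 () := by
  by_cases h : ∃ y, p y
  · obtain ⟨y, hy⟩ := h
    have hu : Unique {y : X // p y} := ⟨⟨⟨y, hy⟩⟩, fun z => Subtype.ext (hp _ _ z.2 hy)⟩
    rw [Set.indicator_of_mem (show () ∈ {_x : Unit | ∃ y, p y} from ⟨y, hy⟩)]
    simp
  · have : IsEmpty {y : X // p y} := ⟨fun z => h ⟨z.1, z.2⟩⟩
    rw [Set.indicator_of_notMem (show () ∉ {_x : Unit | ∃ y, p y} from h)]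
    simp

lemma aux_tsum_union {X : Type*} (p : X → Prop) (A : ℕ → X → Prop)
    (hA : ∀ n a b, A n a → A n b → a = b) (hd : ∀ n m a, A n a → A m a → n = m)
    (hp : ∀ a, p a ↔ ∃ n, A n a) :
    (∑' _ : {y : X // p y}, (1 : ℝ≥0∞))
      = ∑' n, Set.indicator {_x : Unit | ∃ y, A n y} 1 () := by
  have h1 : ∀ q : X → Prop, (∑' _ : {y : X // q y}, (1 : ℝ≥0∞))
      = ∑' y, Set.indicator {y | q y} 1 y := fun q => tsum_subtype {y | q y} (fun _ => (1 : ℝ≥0∞))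
  simp_rw [← fun n => aux_tsum_subsingleton (A n) (hA n), h1]
  rw [ENNReal.tsum_comm]
  congr 1
  funext a
  by_cases h : p a
  · obtain ⟨n, hn⟩ := (hp a).1 h
    rw [Set.indicator_of_mem (show a ∈ {y | p y} from h), tsum_eq_single n]
    · rw [Set.indicator_of_mem (show a ∈ {y | A n y} from hn)]
    · intro m hm
      exact Set.indicator_of_notMem (fun h' => hm (hd _ _ _ h' hn)) _
  · rw [Set.indicator_of_notMem (show a ∉ {y | p y} from h), eq_comm, ENNReal.tsum_eq_zero]
    intro n
    exact Set.indicator_of_notMem (fun h' => h ((hp a).2 ⟨n, h'⟩)) _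

lemma aux_pieces {X : Type*} [MeasurableSpace X] [StandardBorelSpace X]
    (μ : Measure X) [IsFiniteMeasure μ]
    (R : X → X → Prop) (hR : Equivalence R)
    (hcount : ∀ x : X, {y : X | R x y}.Countable)
    (hmeas : MeasurableSet {p : X × X | R p.1 p.2}) :
    ∃ 𝓔 : Set (Set (X × X)), 𝓔.Countable ∧ (∀ E ∈ 𝓔, MeasurableSet E ∧ (∀ p ∈ E, R p.1 p.2) ∧
      Set.InjOn Prod.fst E ∧ Set.InjOn Prod.snd E) ∧
      ∀ᵐ x ∂μ, ∀ y, R x y → (x, y) ∈ ⋃₀ 𝓔 := by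
  have hZ : StandardBorelSpace {p : X × X // R p.1 p.2} := hmeas.standardBorel
  let f : {p : X × X // R p.1 p.2} → X := fun z => z.1.1
  let g : {p : X × X // R p.1 p.2} → X := fun z => z.1.2
  have hf : Measurable f := measurable_fst.comp measurable_subtype_coe
  have hg : Measurable g := measurable_snd.comp measurable_subtype_coe
  have hfc : ∀ x, (f ⁻¹' {x}).Countable := by
    intro x
    refine Set.MapsTo.countable_of_injOn (f := g) (t := {y | R x y}) ?_ ?_ ?_
    · rintro z rfl
      exact z.2
    · rintro ⟨⟨a, b⟩, h⟩ h1 ⟨⟨a', b'⟩, h'⟩ h2 h3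
      simp only [f, g, Set.mem_preimage, Set.mem_singleton_iff] at h1 h2 h3
      subst h1 h2 h3; rfl
    · exact hcount x
  have hgc : ∀ x, (g ⁻¹' {x}).Countable := by
    intro x
    refine Set.MapsTo.countable_of_injOn (f := f) (t := {y | R x y}) ?_ ?_ ?_
    · rintro z rfl
      exact hR.symm z.2
    · rintro ⟨⟨a, b⟩, h⟩ h1 ⟨⟨a', b'⟩, h'⟩ h2 h3
      simp only [f, g, Set.mem_preimage, Set.mem_singleton_iff] at h1 h2 h3
      subst h1 h2 h3; rfl
    · exact hcount x
  obtain ⟨𝓑, h𝓑c, h𝓑, h𝓑0⟩ := aux_LN μ f hf hfc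
  have hC : ∀ B : Set {p : X × X // R p.1 p.2}, ∃ 𝓒 : Set (Set {p : X × X // R p.1 p.2}),
      B ∈ 𝓑 → 𝓒.Countable ∧ (∀ C ∈ 𝓒, MeasurableSet C ∧ Set.InjOn g C) ∧
        μ (f '' (B ∩ (⋃₀ 𝓒)ᶜ)) = 0 := by
    intro B
    by_cases hB : B ∈ 𝓑
    swap
    · exact ⟨∅, fun h => absurd h hB⟩
    obtain ⟨hBm, hBi⟩ := h𝓑 B hB
    have : StandardBorelSpace B := hBm.standardBorel
    have he : MeasurableEmbedding (fun z : B => f z.1) :=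
      (hf.comp measurable_subtype_coe).measurableEmbedding
        (fun z w h => Subtype.ext (hBi z.2 w.2 h))
    have hfin : IsFiniteMeasure (μ.comap (fun z : B => f z.1)) := by
      constructor
      rw [he.comap_apply]
      exact measure_lt_top _ _
    have hgB : Measurable (fun z : B => g z.1) := hg.comp measurable_subtype_coe
    obtain ⟨𝓒, h1, h2, h3⟩ := aux_LN ((μ.comap (fun z : B => f z.1)).map (fun z : B => g z.1)) g hg hgc
    refine ⟨𝓒, fun _ => ⟨h1, h2, ?_⟩⟩
    obtain ⟨N, hN, hNm, hN0⟩ := exists_measurable_superset_of_null h3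
    rw [Measure.map_apply hgB hNm, he.comap_apply] at hN0
    refine measure_mono_null ?_ hN0
    rintro _ ⟨z, ⟨hzB, hz⟩, rfl⟩
    exact ⟨⟨z, hzB⟩, hN ⟨z, hz, rfl⟩, rfl⟩
  choose 𝓒 h𝓒 using hC
  refine ⟨⋃ B ∈ 𝓑, (fun C => Subtype.val '' (B ∩ C)) '' 𝓒 B, ?_, ?_, ?_⟩
  · exact h𝓑c.biUnion fun B hB => (h𝓒 B hB).1.image _
  · intro E hE
    obtain ⟨B, hB, C, hC, rfl⟩ := Set.mem_iUnion₂.1 hE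
    obtain ⟨hBm, hBi⟩ := h𝓑 B hB
    obtain ⟨hCm, hCi⟩ := (h𝓒 B hB).2.1 C hC
    refine ⟨hmeas.subtype_image (hBm.inter hCm), ?_, ?_, ?_⟩
    · rintro _ ⟨z, -, rfl⟩
      exact z.2
    · rintro _ ⟨z, hz, rfl⟩ _ ⟨w, hw, rfl⟩ h
      rw [hBi hz.1 hw.1 h]
    · rintro _ ⟨z, hz, rfl⟩ _ ⟨w, hw, rfl⟩ h
      rw [hCi hz.2 hw.2 h]
  · have hae1 : ∀ᵐ x ∂μ, x ∉ f '' (⋃₀ 𝓑)ᶜ := measure_eq_zero_iff_ae_notMem.1 h𝓑0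
    have hae2 : ∀ᵐ x ∂μ, ∀ B ∈ 𝓑, x ∉ f '' (B ∩ (⋃₀ 𝓒 B)ᶜ) :=
      (ae_ball_iff h𝓑c).2 fun B hB => measure_eq_zero_iff_ae_notMem.1 (h𝓒 B hB).2.2
    filter_upwards [hae1, hae2] with x hx1 hx2 y hxy
    have hz : (⟨(x, y), hxy⟩ : {p : X × X // R p.1 p.2}) ∈ ⋃₀ 𝓑 := by
      by_contra h
      exact hx1 ⟨_, h, rfl⟩
    obtain ⟨B, hB, hzB⟩ := hz
    have hz' : (⟨(x, y), hxy⟩ : {p : X × X // R p.1 p.2}) ∈ ⋃₀ 𝓒 B := by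
      by_contra h
      exact hx2 B hB ⟨_, ⟨hzB, h⟩, rfl⟩
    obtain ⟨C, hC, hzC⟩ := hz'
    exact ⟨_, Set.mem_biUnion hB ⟨C, hC, rfl⟩, _, ⟨hzB, hzC⟩, rfl⟩

open Classical in
lemma aux_swap {X : Type*} [MeasurableSpace X] [StandardBorelSpace X]
    (μ : Measure X) (R : X → X → Prop) (hR : Equivalence R)
    (hinv : ∀ T : X ≃ X, Measurable (T : X → X) → Measurable (T.symm : X → X) →
        (∀ x : X, R x (T x)) → Measure.map (T : X → X) μ = μ)
    (E : Set (X × X)) (hEm : MeasurableSet E) (hER : ∀ p ∈ E, R p.1 p.2)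
    (h1 : Set.InjOn Prod.fst E) (h2 : Set.InjOn Prod.snd E)
    (hd : ∀ p ∈ E, ∀ q ∈ E, p.1 ≠ q.2) : μ (Prod.fst '' E) = μ (Prod.snd '' E) := by
  let G : Set (X × X) := E ∪ Prod.swap ⁻¹' E
  have hGm : MeasurableSet G := hEm.union (measurable_swap hEm)
  have hGR : ∀ p ∈ G, R p.1 p.2 := by
    rintro p (h | h)
    · exact hER p h
    · exact hR.symm (hER _ h)
  have hGs : ∀ x y, (x, y) ∈ G → (y, x) ∈ G := by
    rintro x y (h | h)
    · exact Or.inr h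
    · exact Or.inl h
  have hGf : ∀ x y z, (x, y) ∈ G → (x, z) ∈ G → y = z := by
    rintro x y z (h | h) (h' | h')
    · exact congrArg Prod.snd (h1 h h' rfl)
    · exact absurd rfl (hd _ h _ h')
    · exact absurd rfl (hd _ h' _ h)
    · exact congrArg Prod.fst (h2 h h' rfl)
  have hGinj : Set.InjOn Prod.fst G := by
    rintro ⟨a, b⟩ h ⟨a', b'⟩ h' (rfl : a = a')
    rw [hGf _ _ _ h h']
  let T : X → X := fun x => if h : ∃ y, (x, y) ∈ G then h.choose else x
  have hT1 : ∀ x y, (x, y) ∈ G → T x = y := by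
    intro x y h
    have hex : ∃ y, (x, y) ∈ G := ⟨y, h⟩
    have : T x = hex.choose := dif_pos hex
    rw [this]
    exact hGf _ _ _ hex.choose_spec h
  have hT2 : ∀ x, (¬ ∃ y, (x, y) ∈ G) → T x = x := fun x h => dif_neg h
  have hTT : Function.Involutive T := by
    intro x
    by_cases h : ∃ y, (x, y) ∈ G
    · obtain ⟨y, hy⟩ := h
      rw [hT1 _ _ hy, hT1 _ _ (hGs _ _ hy)]
    · rw [hT2 x h, hT2 x h]
  have hTm : Measurable T := by
    intro D hD
    have : T ⁻¹' D = Prod.fst '' (G ∩ Prod.snd ⁻¹' D) ∪ (D \ Prod.fst '' G) := by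
      ext x
      by_cases h : ∃ y, (x, y) ∈ G
      · obtain ⟨y, hy⟩ := h
        rw [Set.mem_preimage, hT1 _ _ hy]
        constructor
        · intro hyD
          exact Or.inl ⟨(x, y), ⟨hy, hyD⟩, rfl⟩
        · rintro (⟨⟨a, b⟩, ⟨hab, hb⟩, rfl⟩ | ⟨-, h⟩)
          · rw [hGf _ _ _ hy hab]; exact hb
          · exact absurd ⟨(x, y), hy, rfl⟩ h
      · rw [Set.mem_preimage, hT2 x h]
        constructor
        · intro hxD
          refine Or.inr ⟨hxD, ?_⟩
          rintro ⟨⟨a, b⟩, hab, rfl⟩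
          exact h ⟨b, hab⟩
        · rintro (⟨⟨a, b⟩, ⟨hab, hb⟩, rfl⟩ | ⟨h, -⟩)
          · exact absurd ⟨b, hab⟩ h
          · exact h
    rw [this]
    exact ((hGm.inter (measurable_snd hD)).image_of_measurable_injOn measurable_fst
      (hGinj.mono Set.inter_subset_left)).union
      (hD.diff (hGm.image_of_measurable_injOn measurable_fst hGinj))
  have hTR : ∀ x, R x (T x) := by
    intro x
    by_cases h : ∃ y, (x, y) ∈ G
    · obtain ⟨y, hy⟩ := h
      rw [hT1 _ _ hy]; exact hGR _ hy
    · rw [hT2 x h]; exact hR.refl x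
  have hμ := hinv hTT.toPerm hTm hTm hTR
  have hBm : MeasurableSet (Prod.snd '' E) := hEm.image_of_measurable_injOn measurable_snd h2
  have hpre : T ⁻¹' (Prod.snd '' E) = Prod.fst '' E := by
    ext x
    constructor
    · rintro ⟨⟨a, b⟩, hab, h⟩
      refine ⟨(a, b), hab, ?_⟩
      have hb : T b = a := hT1 _ _ (hGs _ _ (Or.inl hab))
      change b = T x at h
      rw [← hTT x, ← h, hb]
    · rintro ⟨⟨a, b⟩, hab, rfl⟩
      exact ⟨(a, b), hab, (hT1 _ _ (Or.inl hab)).symm⟩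
  conv_rhs => rw [← hμ]
  rw [Measure.map_apply (by exact hTm) hBm]
  exact congrArg μ hpre.symm

lemma aux_diag_cover (X : Type*) [MeasurableSpace X] [StandardBorelSpace X] :
    ∃ 𝓖 : Set (Set (X × X)), 𝓖.Countable ∧ (∀ G ∈ 𝓖, MeasurableSet G ∧
      ((∀ p ∈ G, p.1 = p.2) ∨ (∀ p ∈ G, ∀ q ∈ G, p.1 ≠ q.2))) ∧ ⋃₀ 𝓖 = Set.univ := by
  obtain ⟨S, hS, hsep⟩ := exists_seq_separating X (p := MeasurableSet) MeasurableSet.empty Set.univ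
  refine ⟨{Set.diagonal X} ∪ (Set.range (fun n => S n ×ˢ (S n)ᶜ) ∪
    Set.range (fun n => (S n)ᶜ ×ˢ S n)), ?_, ?_, ?_⟩
  · exact (Set.countable_singleton _).union ((Set.countable_range _).union (Set.countable_range _))
  · rintro G (rfl | ⟨n, rfl⟩ | ⟨n, rfl⟩)
    · exact ⟨measurableSet_diagonal, Or.inl fun p hp => hp⟩
    · refine ⟨(hS n).prod (hS n).compl, Or.inr fun p hp q hq h => hq.2 (h ▸ hp.1)⟩
    · refine ⟨(hS n).compl.prod (hS n), Or.inr fun p hp q hq h => hp.1 (h ▸ hq.2)⟩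
  · rw [Set.eq_univ_iff_forall]
    rintro ⟨x, y⟩
    by_cases hxy : x = y
    · exact ⟨_, Or.inl rfl, hxy⟩
    · have : ∃ n, ¬ (x ∈ S n ↔ y ∈ S n) := by
        by_contra! h
        exact hxy (hsep x trivial y trivial h)
      obtain ⟨n, hn⟩ := this
      by_cases hx : x ∈ S n
      · exact ⟨_, Or.inr (Or.inl ⟨n, rfl⟩), hx, fun hy => hn (iff_of_true hx hy)⟩
      · refine ⟨_, Or.inr (Or.inr ⟨n, rfl⟩), hx, ?_⟩
        by_contra hy
        exact hn (iff_of_false hx hy)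

lemma aux_seq {X : Type*} [MeasurableSpace X] [StandardBorelSpace X]
    (μ : Measure X) [IsFiniteMeasure μ]
    (R : X → X → Prop) (hR : Equivalence R)
    (hcount : ∀ x : X, {y : X | R x y}.Countable)
    (hmeas : MeasurableSet {p : X × X | R p.1 p.2})
    (hinv : ∀ T : X ≃ X, Measurable (T : X → X) → Measurable (T.symm : X → X) →
        (∀ x : X, R x (T x)) → Measure.map (T : X → X) μ = μ) :
    ∃ E : ℕ → Set (X × X), (∀ n, MeasurableSet (E n) ∧ (∀ p ∈ E n, R p.1 p.2) ∧
      Set.InjOn Prod.fst (E n) ∧ Set.InjOn Prod.snd (E n)) ∧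
      (∀ n S, MeasurableSet S → μ (Prod.fst '' (E n ∩ S)) = μ (Prod.snd '' (E n ∩ S))) ∧
      (∀ n m p, p ∈ E n → p ∈ E m → n = m) ∧
      ∀ᵐ x ∂μ, ∀ y, R x y → (∃ n, (x, y) ∈ E n) ∧ ∃ n, (y, x) ∈ E n := by
  obtain ⟨𝓔, hc, hE, hcov⟩ := aux_pieces μ R hR hcount hmeas
  obtain ⟨𝓖, hGc, hG, hGcov⟩ := aux_diag_cover X
  let 𝓢 : Set (Set (X × X)) := 𝓔 ∪ (fun E => Prod.swap ⁻¹' E) '' 𝓔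
  have hSc : 𝓢.Countable := hc.union (hc.image _)
  have hS : ∀ E ∈ 𝓢, MeasurableSet E ∧ (∀ p ∈ E, R p.1 p.2) ∧
      Set.InjOn Prod.fst E ∧ Set.InjOn Prod.snd E := by
    rintro E (h | ⟨E, h, rfl⟩)
    · exact hE E h
    · obtain ⟨h1, h2, h3, h4⟩ := hE E h
      refine ⟨measurable_swap h1, fun p hp => hR.symm (h2 _ hp), ?_, ?_⟩
      · intro p hp q hq h
        exact Prod.swap_injective (h4 hp hq h)
      · intro p hp q hq h
        exact Prod.swap_injective (h3 hp hq h)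
  let 𝓠 : Set (Set (X × X)) := insert ∅ (Set.image2 (· ∩ ·) 𝓢 𝓖)
  have hQc : 𝓠.Countable := (hSc.image2 hGc _).insert _
  have hQ : ∀ E ∈ 𝓠, MeasurableSet E ∧ (∀ p ∈ E, R p.1 p.2) ∧
      Set.InjOn Prod.fst E ∧ Set.InjOn Prod.snd E ∧
      ((∀ p ∈ E, p.1 = p.2) ∨ (∀ p ∈ E, ∀ q ∈ E, p.1 ≠ q.2)) := by
    rintro E (rfl | ⟨A, hA, G, hGm, rfl⟩)
    · simp
    · obtain ⟨h1, h2, h3, h4⟩ := hS A hA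
      obtain ⟨h5, h6⟩ := hG G hGm
      refine ⟨h1.inter h5, fun p hp => h2 p hp.1, h3.mono Set.inter_subset_left,
        h4.mono Set.inter_subset_left, ?_⟩
      rcases h6 with h6 | h6
      · exact Or.inl fun p hp => h6 p hp.2
      · exact Or.inr fun p hp q hq => h6 p hp.2 q hq.2
  obtain ⟨F, hF⟩ := hQc.exists_eq_range ⟨∅, Or.inl rfl⟩
  have hFQ : ∀ n, F n ∈ 𝓠 := fun n => hF ▸ Set.mem_range_self n
  have hsub : ∀ n, disjointed F n ⊆ F n := fun n => disjointed_subset F n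
  have hcov' : ∀ p, p ∈ ⋃₀ 𝓢 → ∃ n, p ∈ disjointed F n := by
    rintro p ⟨A, hA, hp⟩
    have : p ∈ ⋃₀ 𝓖 := hGcov ▸ Set.mem_univ p
    obtain ⟨G, hGm, hpG⟩ := this
    have hAG : A ∩ G ∈ 𝓠 := Or.inr ⟨A, hA, G, hGm, rfl⟩
    rw [hF] at hAG
    obtain ⟨n, hn⟩ := hAG
    have : p ∈ ⋃ n, disjointed F n := by
      rw [iUnion_disjointed]
      exact Set.mem_iUnion.2 ⟨n, hn ▸ ⟨hp, hpG⟩⟩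
    exact Set.mem_iUnion.1 this
  have hm : ∀ n, MeasurableSet (disjointed F n) :=
    MeasurableSet.disjointed fun n => (hQ _ (hFQ n)).1
  refine ⟨disjointed F, fun n => ?_, fun n S hSm => ?_, fun n m p hp hq => ?_, ?_⟩
  · obtain ⟨h1, h2, h3, h4, -⟩ := hQ _ (hFQ n)
    exact ⟨hm n, fun p hp => h2 p (hsub n hp), h3.mono (hsub n), h4.mono (hsub n)⟩
  · obtain ⟨h1, h2, h3, h4, h5⟩ := hQ _ (hFQ n)
    have hs : disjointed F n ∩ S ⊆ F n := Set.inter_subset_left.trans (hsub n)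
    rcases h5 with h5 | h5
    · congr 1
      exact Set.image_congr fun p hp => h5 p (hs hp)
    · exact aux_swap μ R hR hinv _ ((hm n).inter hSm) (fun p hp => h2 p (hs hp)) (h3.mono hs)
        (h4.mono hs) (fun p hp q hq => h5 p (hs hp) q (hs hq))
  · by_contra hne
    exact Set.disjoint_left.1 (disjoint_disjointed F hne) hp hq
  · filter_upwards [hcov] with x hx y hxy
    obtain ⟨A, hA, hp⟩ := hx y hxy
    exact ⟨hcov' _ ⟨A, Or.inl hA, hp⟩, hcov' _ ⟨_, Or.inr ⟨A, hA, rfl⟩, hp⟩⟩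



/-- Let `R` be a countable Borel equivalence relation on a standard Borel
space `X` and `μ` a Borel probability measure. The left and right counting measures `μ_l`,
`μ_r` on `R` (given on a Borel `S ⊆ X × X` by integrating the number of `y ∈ [x]` with
`(x,y) ∈ S`, resp. `(y,x) ∈ S`) coincide if and only if `μ` is invariant under every Borel
automorphism of `X` whose graph is contained in `R`. -/
theorem stmt7 {X : Type*} [MeasurableSpace X] [StandardBorelSpace X]
    (μ : Measure X) [IsProbabilityMeasure μ]
    (R : X → X → Prop) (hR : Equivalence R)
    (hcount : ∀ x : X, {y : X | R x y}.Countable)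
    (hmeas : MeasurableSet {p : X × X | R p.1 p.2}) :
    (∀ S : Set (X × X), MeasurableSet S →
        ∫⁻ x, (∑' _ : {y : X // R x y ∧ (x, y) ∈ S}, (1 : ℝ≥0∞)) ∂μ
          = ∫⁻ x, (∑' _ : {y : X // R x y ∧ (y, x) ∈ S}, (1 : ℝ≥0∞)) ∂μ)
    ↔ (∀ T : X ≃ X, Measurable (T : X → X) → Measurable (T.symm : X → X) →
        (∀ x : X, R x (T x)) → Measure.map (T : X → X) μ = μ) := by
  constructor
  · intro h T hT hT' hTR
    ext A hA
    rw [Measure.map_apply hT hA]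
    have hS : MeasurableSet {p : X × X | p.2 = T p.1 ∧ p.2 ∈ A} :=
      (measurableSet_eq_fun measurable_snd (hT.comp measurable_fst)).inter (measurable_snd hA)
    have key := h _ hS
    have e1 : ∀ x, (∑' _ : {y : X // R x y ∧ (x, y) ∈ {p : X × X | p.2 = T p.1 ∧ p.2 ∈ A}},
        (1 : ℝ≥0∞)) = (T ⁻¹' A).indicator 1 x := by
      intro x
      rw [aux_tsum_subsingleton _ (fun a b ha hb => ha.2.1.trans hb.2.1.symm)]
      by_cases hx : T x ∈ A
      · rw [Set.indicator_of_mem (show x ∈ T ⁻¹' A from hx)]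
        refine Set.indicator_of_mem ?_ _
        exact ⟨T x, hTR x, rfl, hx⟩
      · rw [Set.indicator_of_notMem (show x ∉ T ⁻¹' A from hx)]
        refine Set.indicator_of_notMem ?_ _
        rintro ⟨y, -, hy, hyA⟩
        exact hx (by rw [← show y = T x from hy]; exact hyA)
    have e2 : ∀ x, (∑' _ : {y : X // R x y ∧ (y, x) ∈ {p : X × X | p.2 = T p.1 ∧ p.2 ∈ A}},
        (1 : ℝ≥0∞)) = A.indicator 1 x := by
      intro x
      rw [aux_tsum_subsingleton _ (fun a b ha hb => T.injective (ha.2.1.symm.trans hb.2.1))]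
      by_cases hx : x ∈ A
      · rw [Set.indicator_of_mem hx]
        refine Set.indicator_of_mem ?_ _
        refine ⟨T.symm x, ?_, (T.apply_symm_apply x).symm, hx⟩
        have := hTR (T.symm x)
        rw [T.apply_symm_apply] at this
        exact hR.symm this
      · rw [Set.indicator_of_notMem hx]
        refine Set.indicator_of_notMem ?_ _
        rintro ⟨y, -, hy, hyA⟩
        exact hx hyA
    simp_rw [e1, e2] at key
    rwa [lintegral_indicator_one (hT hA), lintegral_indicator_one hA] at key
  · intro hinv S hS
    obtain ⟨E, hE, hEμ, hEd, hcov⟩ := aux_seq μ R hR hcount hmeas hinv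
    have m1 : ∀ n, MeasurableSet (Prod.fst '' (E n ∩ S)) := fun n =>
      ((hE n).1.inter hS).image_of_measurable_injOn measurable_fst
        ((hE n).2.2.1.mono Set.inter_subset_left)
    have m2 : ∀ n, MeasurableSet (Prod.snd '' (E n ∩ S)) := fun n =>
      ((hE n).1.inter hS).image_of_measurable_injOn measurable_snd
        ((hE n).2.2.2.mono Set.inter_subset_left)
    have hconv : ∀ (P Q : Prop), (P ↔ Q) → ∀ (B : Set X) (x : X), (Q ↔ x ∈ B) →
        Set.indicator {_x : Unit | P} (1 : Unit → ℝ≥0∞) () = B.indicator 1 x := by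
      intro P Q hPQ B x hQ
      by_cases hx : x ∈ B
      · rw [Set.indicator_of_mem hx]
        exact Set.indicator_of_mem (show () ∈ {_x : Unit | P} from hPQ.2 (hQ.2 hx)) _
      · rw [Set.indicator_of_notMem hx]
        exact Set.indicator_of_notMem
          (show () ∉ {_x : Unit | P} from fun h => hx (hQ.1 (hPQ.1 h))) _
    have e1 : ∀ᵐ x ∂μ, (∑' _ : {y : X // R x y ∧ (x, y) ∈ S}, (1 : ℝ≥0∞))
        = ∑' n, (Prod.fst '' (E n ∩ S)).indicator 1 x := by
      filter_upwards [hcov] with x hx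
      rw [aux_tsum_union _ (fun n y => (x, y) ∈ E n ∩ S)]
      · congr 1
        funext n
        refine hconv _ _ Iff.rfl _ _ ?_
        constructor
        · rintro ⟨y, hy⟩
          exact ⟨_, hy, rfl⟩
        · rintro ⟨⟨a, b⟩, hab, rfl⟩
          exact ⟨b, hab⟩
      · intro n a b ha hb
        exact congrArg Prod.snd ((hE n).2.2.1 ha.1 hb.1 rfl)
      · intro n m a ha hb
        exact hEd n m _ ha.1 hb.1
      · intro y
        constructor
        · rintro ⟨h1, h2⟩
          obtain ⟨n, hn⟩ := (hx y h1).1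
          exact ⟨n, hn, h2⟩
        · rintro ⟨n, hn, h2⟩
          exact ⟨(hE n).2.1 _ hn, h2⟩
    have e2 : ∀ᵐ x ∂μ, (∑' _ : {y : X // R x y ∧ (y, x) ∈ S}, (1 : ℝ≥0∞))
        = ∑' n, (Prod.snd '' (E n ∩ S)).indicator 1 x := by
      filter_upwards [hcov] with x hx
      rw [aux_tsum_union _ (fun n y => (y, x) ∈ E n ∩ S)]
      · congr 1
        funext n
        refine hconv _ _ Iff.rfl _ _ ?_
        constructor
        · rintro ⟨y, hy⟩
          exact ⟨_, hy, rfl⟩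
        · rintro ⟨⟨a, b⟩, hab, rfl⟩
          exact ⟨a, hab⟩
      · intro n a b ha hb
        exact congrArg Prod.fst ((hE n).2.2.2 ha.1 hb.1 rfl)
      · intro n m a ha hb
        exact hEd n m _ ha.1 hb.1
      · intro y
        constructor
        · rintro ⟨h1, h2⟩
          obtain ⟨n, hn⟩ := (hx y h1).2
          exact ⟨n, hn, h2⟩
        · rintro ⟨n, hn, h2⟩
          exact ⟨hR.symm ((hE n).2.1 _ hn), h2⟩
    rw [lintegral_congr_ae e1, lintegral_congr_ae e2,
      lintegral_tsum (fun n => (measurable_one.indicator (m1 n)).aemeasurable),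
      lintegral_tsum (fun n => (measurable_one.indicator (m2 n)).aemeasurable)]
    congr 1
    funext n
    rw [lintegral_indicator_one (m1 n), lintegral_indicator_one (m2 n)]
    exact hEμ n S hS
end

section
/- Let θ = t·θ₁ + (1−t)·θ₂ be a nontrivial convex combination (0 < t ≤ 1/2, θ₁ ≠ θ₂) of IRSs on a countable group Γ. Then there exist two pmp actions α, β of Γ on a standard probability space, both with IRS θ, and a common finite subalgebra Z of their measure algebras (generated by three atoms of measures t, t, 1−2t, on which Γ acts trivially) such that no pmp action with IRS θ amalgamates α and β over Z. In particular, the class of pmp actions with IRS θ fails the amalgamation property over common subalgebras. -/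
open MeasureTheory
open scoped ENNReal

/-- The space of subgroups of `Γ`, with the Borel structure inherited from `{0,1}^Γ`. -/
instance subgroupMeasurableSpace (Γ : Type*) [Group Γ] : MeasurableSpace (Subgroup Γ) :=
  MeasurableSpace.comap (fun (H : Subgroup Γ) (g : Γ) => (g ∈ H : Prop)) inferInstance

namespace IrsAmalg

lemma measurable_subgroup {Γ : Type*} [Group Γ] {X : Type*} [MeasurableSpace X]
    {f : X → Subgroup Γ} (h : ∀ g, MeasurableSet {x | g ∈ f x}) : Measurable f := by
  apply measurable_comap_iff.2
  apply measurable_pi_lambda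
  intro g
  exact measurable_to_prop (by simpa [Set.preimage] using h g)

lemma measurableSet_mem {Γ : Type*} [Group Γ] (g : Γ) :
    MeasurableSet {H : Subgroup Γ | g ∈ H} := by
  have h1 : Measurable (fun (H : Subgroup Γ) (g : Γ) => (g ∈ H : Prop)) := comap_measurable _
  have h2 := (measurable_pi_iff.1 h1) g
  exact measurableSet_setOfPred.2 h2

/-- the reference atomless probability measure -/
noncomputable def lam : Measure ℝ := volume.restrict (Set.Icc 0 1)

instance : IsProbabilityMeasure lam := ⟨by simp [lam]⟩

instance : NullSingletonClass lam := by unfold lam; infer_instance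

/-- iid sequences -/
noncomputable def PP : Measure (ℕ → ℝ) := Measure.infinitePi (fun _ => lam)

instance : IsProbabilityMeasure PP := by unfold PP; infer_instance

lemma map_inj {Q : Type*} (ι : Q → ℕ) (hι : Function.Injective ι) :
    PP.map (fun u q => u (ι q)) = Measure.infinitePi (fun _ : Q => lam) := by
  classical
  apply Measure.eq_infinitePi
  intro s t ht
  rw [Measure.map_apply (by fun_prop) (.pi s.countable_toSet fun _ _ ↦ ht _)]
  have : (fun (u : ℕ → ℝ) q => u (ι q)) ⁻¹' (Set.pi s t)
      = Set.pi (s.image ι) (Function.extend ι t (fun _ => Set.univ)) := by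
    ext u
    simp [Set.mem_pi, hι.extend_apply]
  rw [this, PP, Measure.infinitePi_pi]
  · rw [Finset.prod_image (fun a _ b _ h => hι h)]
    simp [hι.extend_apply]
  · intro i hi
    obtain ⟨q, _, rfl⟩ := Finset.mem_image.1 hi
    simpa [hι.extend_apply] using ht q

lemma map_ker {G : Type*} (a b : G → ℕ) (h : ∀ g g', a g = a g' ↔ b g = b g') :
    PP.map (fun u g => u (a g)) = PP.map (fun u g => u (b g)) := by
  let c : Set.range a → ℕ := fun q => b q.2.choose
  have hc : ∀ g, c ⟨a g, g, rfl⟩ = b g := fun g =>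
    (h _ _).1 (⟨g, rfl⟩ : ∃ x, a x = a g).choose_spec
  have hinj : Function.Injective c := by
    rintro ⟨_, g, rfl⟩ ⟨_, g', rfl⟩ hh
    rw [hc, hc] at hh
    exact Subtype.ext ((h _ _).2 hh)
  have h1 := map_inj (fun q : Set.range a => (q : ℕ)) Subtype.val_injective
  have h2 := map_inj c hinj
  have h3 := congrArg (Measure.map (fun (v : Set.range a → ℝ) g => v ⟨a g, g, rfl⟩))
    (h1.trans h2.symm)
  rw [Measure.map_map (by fun_prop) (by fun_prop), Measure.map_map (by fun_prop) (by fun_prop)] at h3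
  simpa only [Function.comp_def, hc] using h3

lemma ae_inj : ∀ᵐ u ∂PP, Function.Injective u := by
  have key : ∀ m n : ℕ, m ≠ n → ∀ᵐ u ∂PP, u m ≠ u n := by
    intro m n hmn
    have hi := (ProbabilityTheory.iIndepFun_infinitePi (P := fun _ : ℕ => lam)
      (X := fun _ x => x) (fun _ => measurable_id)).indepFun hmn
    have h2 := (ProbabilityTheory.indepFun_iff_map_prod_eq_prod_map_map
      (measurable_pi_apply m).aemeasurable (measurable_pi_apply n).aemeasurable).1 hi
    simp only [Measure.infinitePi_map_eval] at h2
    have hd : (lam.prod lam) {p | p.1 = p.2} = 0 := by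
      rw [Measure.measure_prod_null (measurableSet_eq_fun measurable_fst measurable_snd)]
      filter_upwards with x
      have : Prod.mk x ⁻¹' {p : ℝ × ℝ | p.1 = p.2} = {x} := by ext y; simp [eq_comm]
      rw [this]; simp
    rw [← h2, Measure.map_apply (by fun_prop)
      (measurableSet_eq_fun measurable_fst measurable_snd)] at hd
    rw [ae_iff]
    simpa [PP] using hd
  have : ∀ᵐ u ∂PP, ∀ m n : ℕ, m ≠ n → u m ≠ u n := by
    rw [ae_all_iff]; intro m
    rw [ae_all_iff]; intro n
    by_cases h : m = n
    · simp [h]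
    · simpa [h] using key m n h
  filter_upwards [this] with u hu m n hmn
  by_contra hne
  exact hu m n hne hmn

section
variable {Γ : Type*} [Group Γ] [Countable Γ]

/-- shift action -/
def act (γ : Γ) (f : Γ → ℝ) : Γ → ℝ := fun g => f (γ⁻¹ * g)

lemma act_one (f : Γ → ℝ) : act 1 f = f := by ext; simp [act]
lemma act_mul (γ δ : Γ) (f : Γ → ℝ) : act (γ * δ) f = act γ (act δ f) := by
  ext; simp [act, mul_assoc]
lemma act_meas (γ : Γ) : Measurable (act γ) := by unfold act; fun_prop

/-- stabilizers of the shift -/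
def stab (f : Γ → ℝ) : Subgroup Γ where
  carrier := {γ | act γ f = f}
  one_mem' := act_one f
  mul_mem' := by
    intro a b ha hb
    simp only [Set.mem_ofPred_eq] at *
    rw [act_mul, hb, ha]
  inv_mem' := by
    intro a ha
    simp only [Set.mem_ofPred_eq] at *
    conv_lhs => rw [← ha, ← act_mul, inv_mul_cancel, act_one]

lemma mem_stab (f : Γ → ℝ) (γ : Γ) : γ ∈ stab f ↔ act γ f = f := Iff.rfl

lemma stab_meas : Measurable (stab (Γ := Γ)) := by
  apply measurable_subgroup
  intro g
  simp only [mem_stab]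
  exact measurableSet_eq_fun (act_meas g) measurable_id

/-- enumeration -/
noncomputable def en (Γ : Type*) [Group Γ] [Countable Γ] : ℕ → Γ :=
  (exists_surjective_nat Γ).choose

lemma en_surj : Function.Surjective (en Γ) := (exists_surjective_nat Γ).choose_spec

lemma rep_ex (H : Subgroup Γ) (g : Γ) : ∃ n, en Γ n * g⁻¹ ∈ H := by
  obtain ⟨n, hn⟩ := en_surj g
  exact ⟨n, by simp [hn, H.one_mem]⟩

open Classical in
/-- coset representative -/
noncomputable def rep (H : Subgroup Γ) (g : Γ) : ℕ := Nat.find (rep_ex H g)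

lemma rep_eq (H : Subgroup Γ) (g g' : Γ) : rep H g = rep H g' ↔ g' * g⁻¹ ∈ H := by
  classical
  have s1 : en Γ (rep H g) * g⁻¹ ∈ H := Nat.find_spec (rep_ex H g)
  have s2 : en Γ (rep H g') * g'⁻¹ ∈ H := Nat.find_spec (rep_ex H g')
  constructor
  · intro h
    rw [h] at s1
    have := H.mul_mem (H.inv_mem s2) s1
    simpa [mul_assoc] using this
  · intro h
    unfold rep
    congr 1
    ext n
    have := H.mul_mem_cancel_right (y := en Γ n * g'⁻¹) h
    rw [← this]
    simp [mul_assoc]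

lemma rep_meas (g : Γ) : Measurable (fun H : Subgroup Γ => rep H g) := by
  classical
  apply measurable_find
  intro n
  exact measurableSet_mem _

/-- the random labelling -/
noncomputable def Phi (x : Subgroup Γ × (ℕ → ℝ)) : Γ → ℝ := fun g => x.2 (rep x.1 g)

lemma Phi_meas : Measurable (Phi (Γ := Γ)) := by
  apply measurable_pi_lambda
  intro g
  have h1 : Measurable (fun p : ℕ × (ℕ → ℝ) => p.2 p.1) :=
    measurable_from_prod_countable_right (fun n => by fun_prop)
  exact h1.comp (((rep_meas g).comp measurable_fst).prodMk measurable_snd)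

lemma conj_meas (γ : Γ) : Measurable
    (fun H : Subgroup Γ => Subgroup.map (MulAut.conj γ).toMonoidHom H) := by
  apply measurable_subgroup
  intro g
  have : {H : Subgroup Γ | g ∈ Subgroup.map (MulAut.conj γ).toMonoidHom H}
      = {H | γ⁻¹ * g * γ ∈ H} := by
    ext H
    exact Subgroup.mem_map_equiv.trans (by simp)
  rw [this]
  exact measurableSet_mem _

theorem exists_irs (θ : Measure (Subgroup Γ)) [IsProbabilityMeasure θ]
    (hinv : ∀ γ : Γ, Measure.map
        (fun H : Subgroup Γ => Subgroup.map (MulAut.conj γ).toMonoidHom H) θ = θ) :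
    ∃ ν : Measure (Γ → ℝ), IsProbabilityMeasure ν ∧
      (∀ γ, MeasurePreserving (act γ) ν ν) ∧ Measure.map stab ν = θ := by
  refine ⟨(θ.prod PP).map Phi, Measure.isProbabilityMeasure_map Phi_meas.aemeasurable, ?_, ?_⟩
  · intro γ
    refine ⟨act_meas γ, ?_⟩
    ext s hs
    rw [Measure.map_apply (act_meas γ) hs, Measure.map_apply Phi_meas (act_meas γ hs),
      Measure.map_apply Phi_meas hs, Measure.prod_apply (Phi_meas (act_meas γ hs)),
      Measure.prod_apply (Phi_meas hs)]
    conv_rhs => rw [← hinv γ, lintegral_map (measurable_measure_prodMk_left (Phi_meas hs))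
      (conj_meas γ)]
    apply lintegral_congr
    intro H
    have := map_ker (fun g => rep H (γ⁻¹ * g))
      (fun g => rep (Subgroup.map (MulAut.conj γ).toMonoidHom H) g) (by
        intro g g'
        rw [rep_eq, rep_eq]
        refine Iff.trans ?_ Subgroup.mem_map_equiv.symm
        simp [mul_assoc])
    have h2 := congrArg (fun m => m s) this
    rw [Measure.map_apply (by fun_prop) hs, Measure.map_apply (by fun_prop) hs] at h2
    exact h2
  · rw [Measure.map_map stab_meas Phi_meas]
    have h : ∀ᵐ x ∂(θ.prod PP), (stab ∘ Phi) x = x.1 := by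
      have h0 : ∀ᵐ x ∂(θ.prod PP), Function.Injective x.2 :=
        Measure.quasiMeasurePreserving_snd.ae ae_inj
      filter_upwards [h0] with x hx
      ext γ
      simp only [Function.comp, mem_stab, funext_iff, act, Phi, hx.eq_iff, rep_eq]
      simp
    rw [Measure.map_congr h]
    simp
end

end IrsAmalg

namespace IrsAmalg
section
variable {Γ : Type*} [Group Γ] [Countable Γ]

/-- the model space -/
abbrev XX (Γ : Type*) := ((Γ → ℝ) × (Γ → ℝ)) × Fin 3

lemma sndM (j : Fin 3) : MeasurableSet {x : XX Γ | x.2 = j} :=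
  measurable_snd (measurableSet_singleton j)

/-- the model action: on copy `i` act on the first coordinate, elsewhere on the second -/
def aa (i : Fin 3) (γ : Γ) (x : XX Γ) : XX Γ :=
  if x.2 = i then ((act γ x.1.1, x.1.2), x.2) else ((x.1.1, act γ x.1.2), x.2)

/-- its stabilizers -/
def ss (i : Fin 3) (x : XX Γ) : Subgroup Γ := if x.2 = i then stab x.1.1 else stab x.1.2

lemma aa_snd (i : Fin 3) (γ : Γ) (x : XX Γ) : (aa i γ x).2 = x.2 := by
  unfold aa; split_ifs <;> rfl

lemma aa_one (i : Fin 3) (x : XX Γ) : aa i 1 x = x := by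
  unfold aa; split_ifs <;> simp [act_one]

lemma aa_mul (i : Fin 3) (γ δ : Γ) (x : XX Γ) : aa i (γ * δ) x = aa i γ (aa i δ x) := by
  unfold aa; split_ifs <;> simp_all [act_mul]

lemma mem_ss (i : Fin 3) (x : XX Γ) (γ : Γ) : γ ∈ ss i x ↔ aa i γ x = x := by
  unfold aa ss
  split_ifs <;> simp [mem_stab, Prod.ext_iff]

lemma aa_meas (i : Fin 3) (γ : Γ) : Measurable (aa (Γ := Γ) i γ) := by
  have := act_meas γ
  unfold aa
  refine Measurable.ite (measurable_snd (measurableSet_singleton i)) ?_ ?_ <;> fun_prop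

lemma ss_meas (i : Fin 3) : Measurable (ss (Γ := Γ) i) := by
  have := stab_meas (Γ := Γ)
  unfold ss
  refine Measurable.ite (measurable_snd (measurableSet_singleton i)) ?_ ?_ <;> fun_prop

/-- the model measure -/
noncomputable def mm (c : Fin 3 → ℝ≥0∞) (κ : Measure ((Γ → ℝ) × (Γ → ℝ))) : Measure (XX Γ) :=
  ∑ j, c j • κ.map (fun y => (y, j))

lemma mm_apply (c : Fin 3 → ℝ≥0∞) (κ : Measure ((Γ → ℝ) × (Γ → ℝ))) {s : Set (XX Γ)}
    (hs : MeasurableSet s) : mm c κ s = ∑ j, c j * κ {y | (y, j) ∈ s} := by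
  simp only [mm, Measure.finsetSum_apply, Measure.smul_apply, smul_eq_mul]
  refine Finset.sum_congr rfl fun j _ => ?_
  rw [Measure.map_apply (by fun_prop) hs]
  rfl

lemma aa_mp (c : Fin 3 → ℝ≥0∞) (ν₁ ν₂ : Measure (Γ → ℝ)) [IsProbabilityMeasure ν₁]
    [IsProbabilityMeasure ν₂] (h1 : ∀ γ, MeasurePreserving (act γ) ν₁ ν₁)
    (h2 : ∀ γ, MeasurePreserving (act γ) ν₂ ν₂) (i : Fin 3) (γ : Γ) :
    MeasurePreserving (aa i γ) (mm c (ν₁.prod ν₂)) (mm c (ν₁.prod ν₂)) := by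
  refine ⟨aa_meas i γ, ?_⟩
  ext s hs
  rw [Measure.map_apply (aa_meas i γ) hs, mm_apply _ _ (aa_meas i γ hs), mm_apply _ _ hs]
  refine Finset.sum_congr rfl fun j _ => ?_
  congr 1
  have hm : MeasurableSet {y : (Γ → ℝ) × (Γ → ℝ) | (y, j) ∈ s} :=
    (measurable_id.prodMk measurable_const) hs
  by_cases hj : j = i
  · have e := ((h1 γ).prod (MeasurePreserving.id ν₂)).measure_preimage hm.nullMeasurableSet
    rw [← e]
    congr 1
    ext y
    simp [aa, hj, Prod.map]
  · have e := ((MeasurePreserving.id ν₁).prod (h2 γ)).measure_preimage hm.nullMeasurableSet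
    rw [← e]
    congr 1
    ext y
    simp [aa, hj, Prod.map]

lemma mm_stab (c : Fin 3 → ℝ≥0∞) (ν₁ ν₂ : Measure (Γ → ℝ)) [IsProbabilityMeasure ν₁]
    [IsProbabilityMeasure ν₂] (i j : Fin 3) {B : Set (Subgroup Γ)} (hB : MeasurableSet B) :
    mm c (ν₁.prod ν₂) (ss i ⁻¹' B ∩ {x | x.2 = j}) =
      c j * (if j = i then Measure.map stab ν₁ B else Measure.map stab ν₂ B) := by
  rw [mm_apply _ _ ((ss_meas i hB).inter (sndM j))]
  rw [Finset.sum_eq_single j]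
  · congr 1
    rw [Measure.map_apply stab_meas hB, Measure.map_apply stab_meas hB]
    split_ifs with h
    · have : {y : (Γ → ℝ) × (Γ → ℝ) | (y, j) ∈ ss i ⁻¹' B ∩ {x | x.2 = j}}
          = (stab ⁻¹' B) ×ˢ Set.univ := by ext y; simp [ss, h]
      rw [this, Measure.prod_prod]; simp
    · have : {y : (Γ → ℝ) × (Γ → ℝ) | (y, j) ∈ ss i ⁻¹' B ∩ {x | x.2 = j}}
          = Set.univ ×ˢ (stab ⁻¹' B) := by ext y; simp [ss, h]
      rw [this, Measure.prod_prod]; simp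
  · intro k _ hk
    simp [hk]
  · simp

/-- a.e. ordered subgroups with the same law agree a.e. -/
lemma ae_eq_of_le {W : Type*} [MeasurableSpace W] (η : Measure W) [IsProbabilityMeasure η]
    (S T : W → Subgroup Γ) (hS : Measurable S) (hT : Measurable T)
    (hle : ∀ᵐ w ∂η, S w ≤ T w) (h : η.map S = η.map T) : S =ᵐ[η] T := by
  have : ∀ g : Γ, ∀ᵐ w ∂η, g ∈ S w ↔ g ∈ T w := by
    intro g
    have e : η (S ⁻¹' {H | g ∈ H}) = η (T ⁻¹' {H | g ∈ H}) := by
      rw [← Measure.map_apply hS (measurableSet_mem g), h,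
        Measure.map_apply hT (measurableSet_mem g)]
    have hl : S ⁻¹' {H | g ∈ H} ≤ᵐ[η] T ⁻¹' {H | g ∈ H} := by
      filter_upwards [hle] with w hw using fun x => hw x
    have := ae_eq_of_ae_subset_of_measure_ge hl e.ge
      (hS (measurableSet_mem g)).nullMeasurableSet (measure_ne_top _ _)
    filter_upwards [this] with w hw
    exact iff_of_eq hw
  filter_upwards [ae_all_iff.2 this] with w hw
  exact Subgroup.ext hw

end
end IrsAmalg

open IrsAmalg in
/-- Let `θ = t·θ₁ + (1−t)·θ₂` be a nontrivial convex combination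
(`0 < t ≤ 1/2`, `θ₁ ≠ θ₂`) of IRSs on a countable group `Γ`. Then there exist two pmp
actions `α`, `β` of `Γ` on a standard probability space (here realized on `ℝ`), both with
IRS `θ`, and a common finite subalgebra `Z` of their measure algebras — generated by three
atoms `A 0, A 1, A 2` of measures `t, t, 1−2t` on which `Γ` acts trivially — such that no
pmp action with IRS `θ` amalgamates `α` and `β` over `Z`: there is no action `ζ` with IRS
`θ` admitting factor maps `p` onto `α` and `q` onto `β` which agree on `Z`. In particular
the class of pmp actions with IRS `θ` fails the amalgamation property over common
subalgebras. -/
theorem stmt19 {Γ : Type*} [Group Γ] [Countable Γ]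
    (θ₁ θ₂ : Measure (Subgroup Γ)) [IsProbabilityMeasure θ₁] [IsProbabilityMeasure θ₂]
    (hinv1 : ∀ γ : Γ, Measure.map
        (fun H : Subgroup Γ => Subgroup.map (MulAut.conj γ).toMonoidHom H) θ₁ = θ₁)
    (hinv2 : ∀ γ : Γ, Measure.map
        (fun H : Subgroup Γ => Subgroup.map (MulAut.conj γ).toMonoidHom H) θ₂ = θ₂)
    (hne : θ₁ ≠ θ₂) (t : ℝ) (ht0 : 0 < t) (ht : t ≤ 1 / 2) :
    ∃ (μ : Measure ℝ) (_ : IsProbabilityMeasure μ)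
      (α β : Γ → ℝ → ℝ) (stabα stabβ : ℝ → Subgroup Γ) (A : Fin 3 → Set ℝ),
      -- α and β are pmp actions on (ℝ, μ)
      (∀ γ : Γ, MeasurePreserving (α γ) μ μ) ∧
      (∀ x : ℝ, α 1 x = x) ∧ (∀ (γ δ : Γ) (x : ℝ), α (γ * δ) x = α γ (α δ x)) ∧
      (∀ γ : Γ, MeasurePreserving (β γ) μ μ) ∧
      (∀ x : ℝ, β 1 x = x) ∧ (∀ (γ δ : Γ) (x : ℝ), β (γ * δ) x = β γ (β δ x)) ∧
      -- both have IRS θ = t θ₁ + (1 − t) θ₂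
      (∀ (x : ℝ) (γ : Γ), γ ∈ stabα x ↔ α γ x = x) ∧
      (∀ (x : ℝ) (γ : Γ), γ ∈ stabβ x ↔ β γ x = x) ∧
      Measurable stabα ∧ Measurable stabβ ∧
      Measure.map stabα μ = ENNReal.ofReal t • θ₁ + ENNReal.ofReal (1 - t) • θ₂ ∧
      Measure.map stabβ μ = ENNReal.ofReal t • θ₁ + ENNReal.ofReal (1 - t) • θ₂ ∧
      -- the common subalgebra Z: a partition into three atoms of measures t, t, 1 − 2t,
      -- invariant under both actions (Γ acts trivially on Z)
      (∀ i, MeasurableSet (A i)) ∧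
      (∀ i j, i ≠ j → A i ∩ A j = ∅) ∧ (A 0 ∪ A 1 ∪ A 2 = Set.univ) ∧
      μ (A 0) = ENNReal.ofReal t ∧ μ (A 1) = ENNReal.ofReal t ∧
      μ (A 2) = ENNReal.ofReal (1 - 2 * t) ∧
      (∀ (γ : Γ) (i : Fin 3), α γ ⁻¹' A i =ᵐ[μ] A i) ∧
      (∀ (γ : Γ) (i : Fin 3), β γ ⁻¹' A i =ᵐ[μ] A i) ∧
      -- no amalgamation over Z
      (∀ (W : Type) (_ : MeasurableSpace W) (η : Measure W), IsProbabilityMeasure η →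
        ∀ ζ : Γ → W → W, (∀ γ : Γ, MeasurePreserving (ζ γ) η η) →
          (∀ w : W, ζ 1 w = w) → (∀ (γ δ : Γ) (w : W), ζ (γ * δ) w = ζ γ (ζ δ w)) →
        ∀ stabζ : W → Subgroup Γ, (∀ (w : W) (γ : Γ), γ ∈ stabζ w ↔ ζ γ w = w) →
          Measurable stabζ →
          Measure.map stabζ η = ENNReal.ofReal t • θ₁ + ENNReal.ofReal (1 - t) • θ₂ →
        ∀ p q : W → ℝ, MeasurePreserving p η μ → MeasurePreserving q η μ →
          (∀ γ : Γ, ∀ᵐ w ∂η, p (ζ γ w) = α γ (p w)) →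
          (∀ γ : Γ, ∀ᵐ w ∂η, q (ζ γ w) = β γ (q w)) →
          (∀ i : Fin 3, p ⁻¹' A i =ᵐ[η] q ⁻¹' A i) → False) := by
  obtain ⟨ν₁, hp1, hm1, hs1⟩ := exists_irs θ₁ hinv1
  obtain ⟨ν₂, hp2, hm2, hs2⟩ := exists_irs θ₂ hinv2
  let c : Fin 3 → ℝ≥0∞ := ![ENNReal.ofReal t, ENNReal.ofReal t, ENNReal.ofReal (1 - 2 * t)]
  have hc0 : c 0 = ENNReal.ofReal t := rfl
  have hc1 : c 1 = ENNReal.ofReal t := rfl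
  have hc2 : c 2 = ENNReal.ofReal (1 - 2 * t) := rfl
  have hc12 : ENNReal.ofReal t + ENNReal.ofReal (1 - 2 * t) = ENNReal.ofReal (1 - t) := by
    rw [← ENNReal.ofReal_add (by linarith) (by linarith)]; congr 1; ring
  have hct : ENNReal.ofReal t + ENNReal.ofReal (1 - t) = 1 := by
    rw [← ENNReal.ofReal_add (by linarith) (by linarith)]; simp
  let m := mm c (ν₁.prod ν₂)
  have hmA : ∀ j, m {x | x.2 = j} = c j := by
    intro j
    have := mm_stab c ν₁ ν₂ 0 j (B := Set.univ) MeasurableSet.univ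
    rw [hs1, hs2] at this
    simpa using this
  have hsum : ∀ s, MeasurableSet s → m s = m (s ∩ {x | x.2 = 0}) + m (s ∩ {x | x.2 = 1})
      + m (s ∩ {x | x.2 = 2}) := by
    intro s hs
    have hj : ∀ j : Fin 3, MeasurableSet {x : XX Γ | x.2 = j} := fun j =>
      measurable_snd (measurableSet_singleton j)
    simp only [m]
    rw [mm_apply _ _ hs, mm_apply _ _ (hs.inter (hj 0)), mm_apply _ _ (hs.inter (hj 1)),
      mm_apply _ _ (hs.inter (hj 2))]
    simp [Fin.sum_univ_three]
  have hmp : IsProbabilityMeasure m := by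
    constructor
    rw [hsum _ MeasurableSet.univ]
    simp only [Set.univ_inter, hmA]
    rw [hc0, hc1, hc2, add_assoc, hc12, hct]
  have hstab : ∀ i : Fin 3, i ≠ 2 → m.map (ss i) =
      ENNReal.ofReal t • θ₁ + ENNReal.ofReal (1 - t) • θ₂ := by
    intro i hi
    ext B hB
    rw [Measure.map_apply (ss_meas i) hB, hsum _ (ss_meas i hB)]
    simp only [m]
    rw [mm_stab c ν₁ ν₂ i 0 hB, mm_stab c ν₁ ν₂ i 1 hB, mm_stab c ν₁ ν₂ i 2 hB, hs1, hs2,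
      hc0, hc1, hc2, ← hc12]
    fin_cases i
    · simp; ring
    · simp; ring
    · simp at hi
  have hunc : ¬ Countable (XX Γ) := by
    intro h
    have hinj : Function.Injective (fun r : ℝ => (((fun _ => r, fun _ => r), 0) : XX Γ)) := by
      intro r r' h
      simp only [Prod.mk.injEq] at h
      exact congrFun h.1.1 1
    have := hinj.countable
    exact not_countable (α := ℝ) this
  let e : XX Γ ≃ᵐ ℝ := PolishSpace.measurableEquivOfNotCountable hunc not_countable
  have he : MeasurePreserving e m (m.map e) := ⟨e.measurable, rfl⟩
  have hes : MeasurePreserving e.symm (m.map e) m := he.symm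
  have hpμ : IsProbabilityMeasure (m.map e) :=
    Measure.isProbabilityMeasure_map e.measurable.aemeasurable
  have hA : ∀ i : Fin 3, MeasurableSet (e.symm ⁻¹' {x | x.2 = i}) := fun i =>
    e.symm.measurable (measurable_snd (measurableSet_singleton i))
  have hμ : ∀ s, MeasurableSet s → m.map e (e.symm ⁻¹' s) = m s := fun s hs =>
    hes.measure_preimage hs.nullMeasurableSet
  refine ⟨m.map e, hpμ,
    fun γ r => e (aa 0 γ (e.symm r)), fun γ r => e (aa 1 γ (e.symm r)),
    fun r => ss 0 (e.symm r), fun r => ss 1 (e.symm r),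
    fun i => e.symm ⁻¹' {x | x.2 = i},
    fun γ => he.comp ((aa_mp c ν₁ ν₂ hm1 hm2 0 γ).comp hes), ?_, ?_,
    fun γ => he.comp ((aa_mp c ν₁ ν₂ hm1 hm2 1 γ).comp hes), ?_, ?_, ?_, ?_,
    (ss_meas 0).comp e.symm.measurable, (ss_meas 1).comp e.symm.measurable, ?_, ?_, hA,
    ?_, ?_, ?_, ?_, ?_, ?_, ?_, ?_⟩
  · simp [aa_one]
  · simp [aa_mul]
  · simp [aa_one]
  · simp [aa_mul]
  · intro x γ
    rw [mem_ss]
    exact e.toEquiv.eq_symm_apply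
  · intro x γ
    rw [mem_ss]
    exact e.toEquiv.eq_symm_apply
  · rw [← hstab 0 (by decide), ← hes.map_eq, Measure.map_map (ss_meas 0) e.symm.measurable, hes.map_eq]
    rfl
  · rw [← hstab 1 (by decide), ← hes.map_eq, Measure.map_map (ss_meas 1) e.symm.measurable, hes.map_eq]
    rfl
  · intro i j hij
    ext x
    simp only [Set.mem_inter_iff, Set.mem_preimage, Set.mem_ofPred_eq, Set.mem_empty_iff_false,
      iff_false, not_and]
    intro h1 h2
    exact hij (h1.symm.trans h2)
  · ext x
    simp only [Set.mem_union, Set.mem_preimage, Set.mem_ofPred_eq, Set.mem_univ, iff_true]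
    generalize (e.symm x).2 = k
    fin_cases k <;> simp
  · rw [hμ _ (sndM _), hmA, hc0]
  · rw [hμ _ (sndM _), hmA, hc1]
  · rw [hμ _ (sndM _), hmA, hc2]
  · intro γ i
    apply Filter.EventuallyEq.of_eq
    ext x
    simp [aa_snd]
  · intro γ i
    apply Filter.EventuallyEq.of_eq
    ext x
    simp [aa_snd]
  · intro W _ η hη ζ hζ hζ1 hζm stabζ hst hstm hmap p q hp hq hpe hqe hpq
    have gen : ∀ (i : Fin 3), i ≠ 2 → ∀ p : W → ℝ, MeasurePreserving p η (m.map e) →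
        (∀ γ : Γ, ∀ᵐ w ∂η, p (ζ γ w) = e (aa i γ (e.symm (p w)))) →
        ∀ B, MeasurableSet B → η (stabζ ⁻¹' B ∩ p ⁻¹' (e.symm ⁻¹' {x | x.2 = 0})) =
          m (ss i ⁻¹' B ∩ {x | x.2 = 0}) := by
      intro i hi p hp hpe B hB
      have hcomp : MeasurePreserving (fun w => e.symm (p w)) η m := hes.comp hp
      have hle : ∀ᵐ w ∂η, stabζ w ≤ ss i (e.symm (p w)) := by
        filter_upwards [ae_all_iff.2 hpe] with w hw γ hγ
        rw [mem_ss]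
        have h1 := hw γ
        rw [(hst w γ).1 hγ] at h1
        apply e.injective
        rw [← h1]; simp
      have hlaw : η.map stabζ = η.map (fun w => ss i (e.symm (p w))) := by
        rw [hmap, ← hstab i hi, ← hcomp.map_eq, Measure.map_map (ss_meas i) hcomp.measurable]
        rfl
      have hae := ae_eq_of_le η stabζ _ hstm ((ss_meas i).comp hcomp.measurable) hle hlaw
      rw [← hcomp.measure_preimage ((ss_meas i hB).inter
        (sndM 0)).nullMeasurableSet]
      apply measure_congr
      filter_upwards [hae] with w hw
      apply propext
      change (stabζ w ∈ B ∧ _) ↔ (ss i (e.symm (p w)) ∈ B ∧ _)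
      rw [hw]
      rfl
    apply hne
    ext B hB
    have h1 := gen 0 (by decide) p hp hpe B hB
    have h2 := gen 1 (by decide) q hq hqe B hB
    have h3 : η (stabζ ⁻¹' B ∩ p ⁻¹' (e.symm ⁻¹' {x | x.2 = 0})) =
        η (stabζ ⁻¹' B ∩ q ⁻¹' (e.symm ⁻¹' {x | x.2 = 0})) :=
      measure_congr ((Filter.EventuallyEq.refl _ _).inter (hpq 0))
    rw [h1, h2] at h3
    simp only [m] at h3
    rw [mm_stab c ν₁ ν₂ 0 0 hB, mm_stab c ν₁ ν₂ 1 0 hB, hs1, hs2, hc0] at h3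
    simp only [if_true, zero_ne_one, if_false] at h3
    exact (ENNReal.mul_right_inj (by simpa using ht0) ENNReal.ofReal_ne_top).1 h3
end
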